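/- Let (A,R) be a minimal triangular Hopf algebra over a field k of characteristic 0. Then the map f_R: A^{*cop} → A defined by f_R(p) = (p⊗I)(R) is an isomorphism of Hopf algebras; consequently G(A) ≅ G(A*), the group G(A) is abelian, and if A is pointed then A* is pointed as well. -/

import Mathlib

open TensorProduct

noncomputable section

universe u v w

namespace Paper

variable (k : Type*) [Field k]

section Basic

variable (A : Type*) [Ring A] [HopfAlgebra k A]

/-- `g` is a grouplike element of the Hopf algebra `A`. -/
def IsGrouplike (g : A) : Prop :=
  Coalgebra.counit (R := k) g = 1 ∧ Coalgebra.comul (R := k) g = g ⊗ₜ[k] g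

/-- `x` is a `g:h` skew primitive element of `A`, i.e. `Δ(x) = x ⊗ g + h ⊗ x`. -/
def IsSkewPrimitive (g h x : A) : Prop :=
  Coalgebra.comul (R := k) x = x ⊗ₜ[k] g + h ⊗ₜ[k] x

/-- The space `P_{g,h}(A)` of `g:h` skew primitives, as a submodule. -/
def skewPrimitives (g h : A) : Submodule k A :=
  LinearMap.ker (Coalgebra.comul (R := k) -
    ((TensorProduct.mk k A A).flip g + TensorProduct.mk k A A h))

end Basic

section Coalg

variable {M : Type*} [AddCommGroup M] [Module k M]

/-- `C` is a subcoalgebra with respect to the comultiplication `d`. -/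
def IsSubcoalgebraOf (d : M →ₗ[k] M ⊗[k] M) (C : Submodule k M) : Prop :=
  ∀ x ∈ C, d x ∈ LinearMap.range (TensorProduct.map C.subtype C.subtype)

/-- `C` is a simple subcoalgebra with respect to `d`. -/
def IsSimpleSubcoalgebraOf (d : M →ₗ[k] M ⊗[k] M) (C : Submodule k M) : Prop :=
  C ≠ ⊥ ∧ IsSubcoalgebraOf k d C ∧
    ∀ D : Submodule k M, IsSubcoalgebraOf k d D → D ≤ C → D = ⊥ ∨ D = C

/-- A coalgebra is pointed if all its simple subcoalgebras are `1`-dimensional. -/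
def IsPointedOf (d : M →ₗ[k] M ⊗[k] M) : Prop :=
  ∀ C : Submodule k M, IsSimpleSubcoalgebraOf k d C → Module.finrank k C = 1

/-- The coradical: the sum of all simple subcoalgebras. -/
def coradicalOf (d : M →ₗ[k] M ⊗[k] M) : Submodule k M :=
  sSup {C | IsSimpleSubcoalgebraOf k d C}

/-- The first term `A₁ = Δ⁻¹(A₀ ⊗ A + A ⊗ A₀)` of the coradical filtration. -/
def firstCoradicalTermOf (d : M →ₗ[k] M ⊗[k] M) : Submodule k M :=
  Submodule.comap d
    (LinearMap.range (TensorProduct.map (coradicalOf k d).subtype (LinearMap.id (M := M))) ⊔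
      LinearMap.range (TensorProduct.map (LinearMap.id (M := M)) (coradicalOf k d).subtype))

end Coalg

section Hopf

variable (A : Type*) [Ring A] [HopfAlgebra k A]

/-- A Hopf algebra is pointed if all its simple subcoalgebras are `1`-dimensional. -/
def IsPointed : Prop := IsPointedOf k (Coalgebra.comul (R := k) (A := A))

/-- A subalgebra `B` of `A` is a sub-Hopf-algebra if it is closed under
comultiplication and under the antipode. -/
def IsSubHopf (B : Subalgebra k A) : Prop :=
  (∀ x ∈ B, Coalgebra.comul (R := k) x ∈
      LinearMap.range (TensorProduct.map B.toSubmodule.subtype B.toSubmodule.subtype)) ∧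
  ∀ x ∈ B, HopfAlgebra.antipode (R := k) x ∈ B

/-- `r` belongs to `K ⊗ K ⊆ A ⊗ A` for a submodule `K` of `A`. -/
def MemTensorSquare (K : Submodule k A) (r : A ⊗[k] A) : Prop :=
  r ∈ LinearMap.range (TensorProduct.map K.subtype K.subtype)

/-- `(Δ ⊗ id)(r) = r₁₃ r₂₃`. -/
def Hexagon₁ (r : A ⊗[k] A) : Prop :=
  Algebra.TensorProduct.map (Bialgebra.comulAlgHom k A) (AlgHom.id k A) r =
    Algebra.TensorProduct.map (Algebra.TensorProduct.includeLeft (R := k) (S := k)) (AlgHom.id k A) r *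
      Algebra.TensorProduct.map (Algebra.TensorProduct.includeRight (R := k)) (AlgHom.id k A) r

/-- `(id ⊗ Δ)(r) = r₁₃ r₁₂`. -/
def Hexagon₂ (r : A ⊗[k] A) : Prop :=
  Algebra.TensorProduct.map (AlgHom.id k A) (Bialgebra.comulAlgHom k A) r =
    Algebra.TensorProduct.map (AlgHom.id k A) (Algebra.TensorProduct.includeRight (R := k)) r *
      Algebra.TensorProduct.map (AlgHom.id k A) (Algebra.TensorProduct.includeLeft (R := k) (S := k)) r

/-- The Drinfeld element `u = Σ S(R⁽²⁾) R⁽¹⁾` associated to an element `r ∈ A ⊗ A`. -/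
def drinfeldOf (r : A ⊗[k] A) : A :=
  LinearMap.mul' k A
    ((TensorProduct.map (HopfAlgebra.antipode (R := k)) LinearMap.id)
      ((TensorProduct.comm k A A) r))

/-- A quasitriangular structure on the Hopf algebra `A`. -/
structure QuasiTriangular where
  /-- the R-matrix -/
  R : A ⊗[k] A
  isUnit : IsUnit R
  intertwine : ∀ a : A,
    (TensorProduct.comm k A A) (Coalgebra.comul (R := k) a) * R = R * Coalgebra.comul (R := k) a
  hexagon₁ : Hexagon₁ k A R
  hexagon₂ : Hexagon₂ k A R

variable {A}

/-- A quasitriangular Hopf algebra is triangular if `R R₂₁ = 1 ⊗ 1`. -/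
def QuasiTriangular.IsTriangular (Q : QuasiTriangular k A) : Prop :=
  Q.R * (TensorProduct.comm k A A) Q.R = 1

/-- `(A,R)` is minimal if no proper sub-Hopf-algebra contains the components of `R`. -/
def QuasiTriangular.IsMinimal (Q : QuasiTriangular k A) : Prop :=
  ∀ B : Subalgebra k A, IsSubHopf k A B → MemTensorSquare k A B.toSubmodule Q.R → B = ⊤

/-- The Drinfeld element of a quasitriangular Hopf algebra. -/
def QuasiTriangular.drinfeld (Q : QuasiTriangular k A) : A := drinfeldOf k A Q.R

/-- The map `f_R : A* → A`, `p ↦ (p ⊗ I)(R)`. -/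
def fR (Q : QuasiTriangular k A) : Module.Dual k A →ₗ[k] A :=
  TensorProduct.lift
    (LinearMap.mk₂ k (fun a b => (Module.Dual.eval k A a).smulRight b)
      (fun a a' b => by ext p; simp [add_smul])
      (fun c a b => by ext p; simp [smul_smul])
      (fun a b b' => by ext p; simp [smul_add])
      (fun c a b => by ext p; simp [smul_comm (p a) c b])) Q.R

/-- Radford's coinvariants `B = {x ∈ A | (I ⊗ π)Δ(x) = x ⊗ 1}` of a projection `π`. -/
def coinvariants (π : A →ₗ[k] A) : Submodule k A :=
  LinearMap.ker
    ((TensorProduct.map LinearMap.id π) ∘ₗ Coalgebra.comul (R := k) -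
      (TensorProduct.mk k A A).flip 1)

end Hopf


section DualHopf

variable (A : Type*) [Ring A] [HopfAlgebra k A]

/-- The convolution product on the dual of `A`: `(p ⋆ q)(a) = Σ p(a₁) q(a₂)`. -/
def conv (p q : Module.Dual k A) : Module.Dual k A :=
  LinearMap.mul' k k ∘ₗ TensorProduct.map p q ∘ₗ Coalgebra.comul (R := k)

variable [FiniteDimensional k A]

/-- The comultiplication of the dual Hopf algebra `A*` of a finite-dimensional
Hopf algebra `A` (the dual of the multiplication of `A`). -/
def dualComul : Module.Dual k A →ₗ[k] Module.Dual k A ⊗[k] Module.Dual k A :=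
  (TensorProduct.dualDistribEquiv k A A).symm.toLinearMap ∘ₗ (LinearMap.mul' k A).dualMap

/-- `f` is an isomorphism of Hopf algebras `A^{*cop} → A`: it is bijective, it is an
algebra map from the convolution algebra `A^{*cop} = (A*)` to `A`, and it is a coalgebra
map from the co-opposite of the dual coalgebra of `A` to `A`. -/
def IsHopfIsoFromDualCop (f : Module.Dual k A →ₗ[k] A) : Prop :=
  Function.Bijective f ∧
  (∀ p q : Module.Dual k A, f (conv k A p q) = f p * f q) ∧
  f (Coalgebra.counit (R := k)) = 1 ∧
  (∀ p : Module.Dual k A, Coalgebra.comul (R := k) (f p) =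
    TensorProduct.map f f
      ((TensorProduct.comm k (Module.Dual k A) (Module.Dual k A)) (dualComul k A p))) ∧
  (∀ p : Module.Dual k A, Coalgebra.counit (R := k) (f p) = p 1)

end DualHopf

section Contraction

variable {k} {A : Type*} [Ring A] [HopfAlgebra k A]

/-- Contraction of the first tensor factor against a linear functional. -/
def contractLeft {M N : Type*} [AddCommGroup M] [Module k M] [AddCommGroup N] [Module k N]
    (p : Module.Dual k M) : M ⊗[k] N →ₗ[k] N :=
  (TensorProduct.lid k N).toLinearMap ∘ₗ LinearMap.rTensor N p

@[simp]
lemma contractLeft_tmul {M N : Type*} [AddCommGroup M] [Module k M] [AddCommGroup N]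
    [Module k N] (p : Module.Dual k M) (m : M) (n : N) :
    contractLeft p (m ⊗ₜ[k] n) = p m • n := by
  simp [contractLeft]

lemma eq_of_contractLeft_eq {M N : Type*} [AddCommGroup M] [Module k M] [AddCommGroup N]
    [Module k N] {x y : M ⊗[k] N}
    (h : ∀ p : Module.Dual k M, contractLeft p x = contractLeft p y) : x = y := by
  classical
  let b := Module.Basis.ofVectorSpace k M
  apply (TensorProduct.equivFinsuppOfBasisLeft (N := N) b).injective
  refine Finsupp.ext fun i => ?_
  rw [TensorProduct.equivFinsuppOfBasisLeft_apply, TensorProduct.equivFinsuppOfBasisLeft_apply]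
  exact h (b.coord i)

lemma contractLeft_map {M N M' N' : Type*} [AddCommGroup M] [Module k M] [AddCommGroup N]
    [Module k N] [AddCommGroup M'] [Module k M'] [AddCommGroup N'] [Module k N']
    (p : Module.Dual k M') (f : M →ₗ[k] M') (g : N →ₗ[k] N') (x : M ⊗[k] N) :
    contractLeft p (TensorProduct.map f g x) = g (contractLeft (p ∘ₗ f) x) := by
  induction x with
  | zero => simp
  | tmul a b => simp
  | add x y hx hy => simp [hx, hy]

lemma fR_apply (Q : QuasiTriangular k A) (p : Module.Dual k A) :
    fR k Q p = contractLeft p Q.R := by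
  unfold fR
  induction Q.R with
  | zero => simp
  | tmul a b => simp
  | add x y hx hy => simp [hx, hy]

lemma contractLeft_conv (p q : Module.Dual k A) (x : A ⊗[k] A) :
    contractLeft (conv k A p q) x =
      contractLeft (LinearMap.mul' k k ∘ₗ TensorProduct.map p q)
        (Algebra.TensorProduct.map (Bialgebra.comulAlgHom k A) (AlgHom.id k A) x) := by
  induction x with
  | zero => simp
  | tmul a b => simp [conv]
  | add x y hx hy => simp [hx, hy]

lemma contractLeft_r13_mul_r23 (p q : Module.Dual k A) (x y : A ⊗[k] A) :
    contractLeft (LinearMap.mul' k k ∘ₗ TensorProduct.map p q)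
      (Algebra.TensorProduct.map (Algebra.TensorProduct.includeLeft (R := k) (S := k))
          (AlgHom.id k A) x *
        Algebra.TensorProduct.map (Algebra.TensorProduct.includeRight (R := k))
          (AlgHom.id k A) y) =
      contractLeft p x * contractLeft q y := by
  induction x with
  | zero => simp
  | add x x' hx hx' => simp [hx, hx', add_mul]
  | tmul a b =>
    induction y with
    | zero => simp
    | add y y' hy hy' => simp only [map_add, mul_add, hy, hy']
    | tmul c d => simp [smul_smul, mul_comm]

lemma fR_conv (Q : QuasiTriangular k A) (p q : Module.Dual k A) :
    fR k Q (conv k A p q) = fR k Q p * fR k Q q := by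
  simp only [fR_apply]
  rw [contractLeft_conv, Q.hexagon₁, contractLeft_r13_mul_r23]

lemma one_tmul_contractLeft_counit_mul (x y : A ⊗[k] A) :
    TensorProduct.map ((TensorProduct.lid k A).toLinearMap ∘ₗ
        TensorProduct.map (Coalgebra.counit (R := k)) LinearMap.id) LinearMap.id
      (Algebra.TensorProduct.map (Algebra.TensorProduct.includeLeft (R := k) (S := k))
          (AlgHom.id k A) x *
        Algebra.TensorProduct.map (Algebra.TensorProduct.includeRight (R := k))
          (AlgHom.id k A) y) =
      (1 ⊗ₜ[k] contractLeft (Coalgebra.counit (R := k)) x) * y := by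
  induction x with
  | zero => simp
  | add x x' hx hx' => simp [hx, hx', add_mul, TensorProduct.tmul_add]
  | tmul a b =>
    induction y with
    | zero => simp
    | add y y' hy hy' => simp only [map_add, mul_add, hy, hy']
    | tmul c d => simp [TensorProduct.smul_tmul]

lemma map_counit_left_comul (x : A ⊗[k] A) :
    TensorProduct.map ((TensorProduct.lid k A).toLinearMap ∘ₗ
        TensorProduct.map (Coalgebra.counit (R := k)) LinearMap.id) LinearMap.id
      (Algebra.TensorProduct.map (Bialgebra.comulAlgHom k A) (AlgHom.id k A) x) = x := by
  induction x with
  | zero => simp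
  | add x x' hx hx' => simp [hx, hx']
  | tmul a b =>
    have h := Coalgebra.rTensor_counit_comul (R := k) a
    rw [LinearMap.rTensor] at h
    simp [h]

lemma fR_counit (Q : QuasiTriangular k A) : fR k Q (Coalgebra.counit (R := k)) = 1 := by
  have h := one_tmul_contractLeft_counit_mul Q.R Q.R
  rw [← Q.hexagon₁, map_counit_left_comul] at h
  have h1 : (1 : A) ⊗ₜ[k] contractLeft (Coalgebra.counit (R := k)) Q.R = 1 :=
    Q.isUnit.mul_right_cancel (by rw [one_mul, ← h])
  have h2 := congrArg (contractLeft (Coalgebra.counit (R := k))) h1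
  rw [Algebra.TensorProduct.one_def] at h2
  simpa [fR_apply] using h2

lemma tmul_one_contract_counit_mul (x y : A ⊗[k] A) :
    TensorProduct.map LinearMap.id ((TensorProduct.lid k A).toLinearMap ∘ₗ
        TensorProduct.map (Coalgebra.counit (R := k)) LinearMap.id)
      (Algebra.TensorProduct.map (AlgHom.id k A)
          (Algebra.TensorProduct.includeRight (R := k)) x *
        Algebra.TensorProduct.map (AlgHom.id k A)
          (Algebra.TensorProduct.includeLeft (R := k) (S := k)) y) =
      x * (contractLeft (Coalgebra.counit (R := k)) (TensorProduct.comm k A A y) ⊗ₜ[k] 1) := by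
  induction y with
  | zero => simp
  | add x x' hx hx' => simp [hx, hx', mul_add, TensorProduct.add_tmul]
  | tmul a b =>
    induction x with
    | zero => simp
    | add y y' hy hy' => simp only [map_add, add_mul, hy, hy']
    | tmul c d => simp [TensorProduct.smul_tmul]

lemma map_counit_right_comul (x : A ⊗[k] A) :
    TensorProduct.map LinearMap.id ((TensorProduct.lid k A).toLinearMap ∘ₗ
        TensorProduct.map (Coalgebra.counit (R := k)) LinearMap.id)
      (Algebra.TensorProduct.map (AlgHom.id k A) (Bialgebra.comulAlgHom k A) x) = x := by
  induction x with
  | zero => simp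
  | add x x' hx hx' => simp [hx, hx']
  | tmul a b =>
    have h := Coalgebra.rTensor_counit_comul (R := k) b
    rw [LinearMap.rTensor] at h
    simp [h]

lemma contractLeft_comm (p q : Module.Dual k A) (x : A ⊗[k] A) :
    q (contractLeft p x) = p (contractLeft q (TensorProduct.comm k A A x)) := by
  induction x with
  | zero => simp
  | add x x' hx hx' => simp [hx, hx']
  | tmul a b => simp [mul_comm]

lemma counit_fR (Q : QuasiTriangular k A) (p : Module.Dual k A) :
    Coalgebra.counit (R := k) (fR k Q p) = p 1 := by
  have h := tmul_one_contract_counit_mul Q.R Q.R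
  rw [← Q.hexagon₂, map_counit_right_comul] at h
  have h1 : contractLeft (Coalgebra.counit (R := k)) (TensorProduct.comm k A A Q.R) ⊗ₜ[k]
      (1 : A) = 1 :=
    Q.isUnit.mul_left_cancel (by rw [mul_one, ← h])
  have h2 := congrArg (contractLeft (Coalgebra.counit (R := k)))
    (congrArg (TensorProduct.comm k A A) h1)
  rw [Algebra.TensorProduct.one_def] at h2
  rw [fR_apply, contractLeft_comm]
  congr 1
  simpa using h2

lemma map_antipode_mul (x y : A ⊗[k] A) :
    TensorProduct.map (LinearMap.mul' k A ∘ₗ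
        TensorProduct.map (HopfAlgebra.antipode (R := k)) LinearMap.id) LinearMap.id
      (Algebra.TensorProduct.map (Algebra.TensorProduct.includeLeft (R := k) (S := k))
          (AlgHom.id k A) x *
        Algebra.TensorProduct.map (Algebra.TensorProduct.includeRight (R := k))
          (AlgHom.id k A) y) =
      TensorProduct.map (HopfAlgebra.antipode (R := k)) LinearMap.id x * y := by
  induction x with
  | zero => simp
  | add x x' hx hx' => simp [hx, hx', add_mul]
  | tmul a b =>
    induction y with
    | zero => simp
    | add y y' hy hy' => simp only [map_add, mul_add, hy, hy']
    | tmul c d => simp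

lemma map_antipode_comul (x : A ⊗[k] A) :
    TensorProduct.map (LinearMap.mul' k A ∘ₗ
        TensorProduct.map (HopfAlgebra.antipode (R := k)) LinearMap.id) LinearMap.id
      (Algebra.TensorProduct.map (Bialgebra.comulAlgHom k A) (AlgHom.id k A) x) =
      1 ⊗ₜ[k] contractLeft (Coalgebra.counit (R := k)) x := by
  induction x with
  | zero => simp
  | add x x' hx hx' => simp [hx, hx', TensorProduct.tmul_add]
  | tmul a b =>
    have h := HopfAlgebra.mul_antipode_rTensor_comul_apply (R := k) a
    rw [LinearMap.rTensor] at h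
    simp [h, Algebra.algebraMap_eq_smul_one, TensorProduct.smul_tmul]

lemma map_antipode_R_mul_R (Q : QuasiTriangular k A) :
    TensorProduct.map (HopfAlgebra.antipode (R := k)) LinearMap.id Q.R * Q.R = 1 := by
  rw [← map_antipode_mul, ← Q.hexagon₁, map_antipode_comul, ← fR_apply, fR_counit,
    Algebra.TensorProduct.one_def]

lemma map_antipode_R {Q : QuasiTriangular k A} (htri : Q.IsTriangular) :
    TensorProduct.map (HopfAlgebra.antipode (R := k)) LinearMap.id Q.R =
      TensorProduct.comm k A A Q.R :=
  left_inv_eq_right_inv (map_antipode_R_mul_R Q) htri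

lemma map_antipode_antipode_R {Q : QuasiTriangular k A} (htri : Q.IsTriangular) :
    TensorProduct.map (HopfAlgebra.antipode (R := k)) (HopfAlgebra.antipode (R := k)) Q.R =
      Q.R := by
  have h := congrArg (TensorProduct.map (LinearMap.id (M := A)) (HopfAlgebra.antipode (R := k)))
    (map_antipode_R htri)
  rw [TensorProduct.map_map, TensorProduct.map_comm, map_antipode_R htri] at h
  simpa using h

lemma contractLeft_comul (p : Module.Dual k A) (x : A ⊗[k] A) :
    Coalgebra.comul (R := k) (contractLeft p x) =
      contractLeft p
        (Algebra.TensorProduct.map (AlgHom.id k A) (Bialgebra.comulAlgHom k A) x) := by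
  induction x with
  | zero => simp
  | tmul a b => simp
  | add x y hx hy => simp [hx, hy]

/-- For `ξ ∈ (A ⊗ A)*`, the map `(a ⊗ b) ⊗ (a' ⊗ b') ↦ ξ(a ⊗ a') b' ⊗ b`. -/
def contractSwap (ξ : Module.Dual k (A ⊗[k] A)) :
    (A ⊗[k] A) ⊗[k] (A ⊗[k] A) →ₗ[k] A ⊗[k] A :=
  (TensorProduct.comm k A A).toLinearMap ∘ₗ contractLeft ξ ∘ₗ
    (TensorProduct.tensorTensorTensorComm k A A A A).toLinearMap

@[simp]
lemma contractSwap_tmul (ξ : Module.Dual k (A ⊗[k] A)) (a b a' b' : A) :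
    contractSwap ξ ((a ⊗ₜ[k] b) ⊗ₜ[k] (a' ⊗ₜ[k] b')) = ξ (a ⊗ₜ[k] a') • (b' ⊗ₜ[k] b) := by
  simp [contractSwap]

lemma contractLeft_r13_mul_r12 (p : Module.Dual k A) (x y : A ⊗[k] A) :
    contractLeft p
      (Algebra.TensorProduct.map (AlgHom.id k A)
          (Algebra.TensorProduct.includeRight (R := k)) x *
        Algebra.TensorProduct.map (AlgHom.id k A)
          (Algebra.TensorProduct.includeLeft (R := k) (S := k)) y) =
      contractSwap (p ∘ₗ LinearMap.mul' k A) (x ⊗ₜ[k] y) := by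
  induction y with
  | zero => simp
  | add x x' hx hx' => simp only [map_add, mul_add, TensorProduct.tmul_add, hx, hx']
  | tmul a b =>
    induction x with
    | zero => simp
    | add y y' hy hy' => simp only [map_add, add_mul, TensorProduct.add_tmul, hy, hy']
    | tmul c d => simp

lemma tmul_contractLeft (φ ψ : Module.Dual k A) (x y : A ⊗[k] A) :
    contractLeft ψ y ⊗ₜ[k] contractLeft φ x =
      contractSwap (TensorProduct.dualDistrib k A A (φ ⊗ₜ[k] ψ)) (x ⊗ₜ[k] y) := by
  induction y with
  | zero => simp
  | add x x' hx hx' => simp only [map_add, TensorProduct.tmul_add, TensorProduct.add_tmul, hx, hx']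
  | tmul a b =>
    induction x with
    | zero => simp
    | add y y' hy hy' =>
      simp only [map_add, TensorProduct.tmul_add, TensorProduct.add_tmul, hy, hy']
    | tmul c d => simp [← TensorProduct.smul_tmul', smul_smul]

lemma map_fR_comm (Q : QuasiTriangular k A)
    (D : Module.Dual k A ⊗[k] Module.Dual k A) :
    TensorProduct.map (fR k Q) (fR k Q) (TensorProduct.comm k _ _ D) =
      contractSwap (TensorProduct.dualDistrib k A A D) (Q.R ⊗ₜ[k] Q.R) := by
  induction D with
  | zero => simp [contractSwap, contractLeft]
  | tmul φ ψ => simp [← tmul_contractLeft, fR_apply]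
  | add x y hx hy =>
    simp only [map_add, hx, hy]
    simp [contractSwap, contractLeft]

lemma dualDistrib_dualComul [FiniteDimensional k A] (p : Module.Dual k A) :
    TensorProduct.dualDistrib k A A (dualComul k A p) = p ∘ₗ LinearMap.mul' k A :=
  (TensorProduct.dualDistribEquiv k A A).apply_symm_apply _

lemma comul_fR [FiniteDimensional k A] (Q : QuasiTriangular k A) (p : Module.Dual k A) :
    Coalgebra.comul (R := k) (fR k Q p) =
      TensorProduct.map (fR k Q) (fR k Q) (TensorProduct.comm k _ _ (dualComul k A p)) := by
  rw [map_fR_comm, dualDistrib_dualComul, ← contractLeft_r13_mul_r12, ← Q.hexagon₂, fR_apply,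
    contractLeft_comul]

/-- The image of `f_R`, as a subalgebra. -/
def rangeFR (Q : QuasiTriangular k A) : Subalgebra k A :=
  (LinearMap.range (fR k Q)).toSubalgebra ⟨_, fR_counit Q⟩ (by
    rintro _ _ ⟨p, rfl⟩ ⟨q, rfl⟩
    exact ⟨_, fR_conv Q p q⟩)

lemma mem_rangeFR {Q : QuasiTriangular k A} {x : A} : x ∈ rangeFR Q ↔ ∃ p, fR k Q p = x :=
  Iff.rfl

lemma antipode_fR_comp_antipode {Q : QuasiTriangular k A} (htri : Q.IsTriangular)
    (p : Module.Dual k A) :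
    HopfAlgebra.antipode (R := k) (fR k Q (p ∘ₗ HopfAlgebra.antipode (R := k))) = fR k Q p := by
  rw [fR_apply, ← contractLeft_map, map_antipode_antipode_R htri, fR_apply]

lemma isSubHopf_rangeFR [FiniteDimensional k A] {Q : QuasiTriangular k A}
    (htri : Q.IsTriangular) : IsSubHopf k A (rangeFR Q) := by
  constructor
  · rintro _ ⟨p, rfl⟩
    rw [comul_fR]
    refine ⟨TensorProduct.map (fR k Q).rangeRestrict (fR k Q).rangeRestrict
      (TensorProduct.comm k _ _ (dualComul k A p)), ?_⟩
    exact TensorProduct.map_map _ _ _ _ _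
  · have hle : LinearMap.range (fR k Q) ≤
        (LinearMap.range (fR k Q)).map (HopfAlgebra.antipode (R := k)) := by
      rintro _ ⟨p, rfl⟩
      exact ⟨_, ⟨_, rfl⟩, antipode_fR_comp_antipode htri p⟩
    have heq := Submodule.eq_of_le_of_finrank_le hle (Submodule.finrank_map_le _ _)
    intro x hx
    change _ ∈ LinearMap.range (fR k Q)
    rw [heq]
    exact Submodule.mem_map_of_mem hx

lemma memTensorSquare_rangeFR {Q : QuasiTriangular k A} (htri : Q.IsTriangular) :
    MemTensorSquare k A (rangeFR Q).toSubmodule Q.R := by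
  obtain ⟨π, hπ⟩ := (rangeFR Q).toSubmodule.subtype.exists_leftInverse_of_injective
    (Submodule.ker_subtype _)
  let P : A →ₗ[k] A := (rangeFR Q).toSubmodule.subtype ∘ₗ π
  have hPf (p : Module.Dual k A) : P (fR k Q p) = fR k Q p :=
    congrArg Subtype.val (LinearMap.congr_fun hπ ⟨fR k Q p, p, rfl⟩)
  have hright : TensorProduct.map LinearMap.id P Q.R = Q.R := by
    refine eq_of_contractLeft_eq fun p => ?_
    rw [contractLeft_map, LinearMap.comp_id, ← fR_apply, hPf]
  have hleft : TensorProduct.map P LinearMap.id Q.R = Q.R := by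
    apply (TensorProduct.comm k A A).injective
    rw [← TensorProduct.map_comm, ← map_antipode_R htri, TensorProduct.map_map,
      LinearMap.id_comp, LinearMap.comp_id]
    conv_rhs => rw [← hright, TensorProduct.map_map, LinearMap.comp_id, LinearMap.id_comp]
  have hboth : TensorProduct.map P P Q.R = Q.R := by
    conv_rhs => rw [← hleft, ← hright, TensorProduct.map_map, LinearMap.comp_id, LinearMap.id_comp]
  refine ⟨TensorProduct.map π π Q.R, ?_⟩
  rw [TensorProduct.map_map]
  exact hboth

lemma fR_bijective [FiniteDimensional k A] {Q : QuasiTriangular k A}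
    (htri : Q.IsTriangular) (hmin : Q.IsMinimal) : Function.Bijective (fR k Q) := by
  have htop := hmin _ (isSubHopf_rangeFR htri) (memTensorSquare_rangeFR htri)
  have hsurj : Function.Surjective (fR k Q) := fun x =>
    mem_rangeFR.1 (htop ▸ Algebra.mem_top : x ∈ rangeFR Q)
  exact ⟨(LinearMap.injective_iff_surjective_of_finrank_eq_finrank
    Subspace.dual_finrank_eq).2 hsurj, hsurj⟩

lemma isGrouplike_fR [FiniteDimensional k A] (Q : QuasiTriangular k A) (η : A →ₐ[k] k) :
    IsGrouplike k A (fR k Q η.toLinearMap) := by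
  refine ⟨by simp [counit_fR], ?_⟩
  have h : dualComul k A η.toLinearMap = η.toLinearMap ⊗ₜ[k] η.toLinearMap := by
    apply (TensorProduct.dualDistribEquiv k A A).injective
    refine (dualDistrib_dualComul _).trans (TensorProduct.ext' fun a b => ?_)
    simp [TensorProduct.dualDistribEquiv]
  rw [comul_fR, h]
  simp

/-- A functional sent by `f_R` to a grouplike element is a character. -/
def characterOfFR [FiniteDimensional k A] (Q : QuasiTriangular k A)
    (hinj : Function.Injective (fR k Q)) (p : Module.Dual k A)
    (hp : IsGrouplike k A (fR k Q p)) : A →ₐ[k] k :=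
  AlgHom.ofLinearMap p (by rw [← counit_fR Q, hp.1]) (by
    have h : dualComul k A p = p ⊗ₜ[k] p := by
      apply (TensorProduct.comm k _ _).injective
      apply TensorProduct.map_injective_of_flat_flat _ _ hinj hinj
      rw [← comul_fR, hp.2]
      simp
    intro a b
    have hab := LinearMap.congr_fun (dualDistrib_dualComul p) (a ⊗ₜ[k] b)
    rw [h] at hab
    simpa using hab.symm)

lemma exists_character_fR_eq [FiniteDimensional k A] {Q : QuasiTriangular k A}
    (hbij : Function.Bijective (fR k Q)) {g : A} (hg : IsGrouplike k A g) :
    ∃ η : A →ₐ[k] k, fR k Q η.toLinearMap = g := by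
  obtain ⟨p, rfl⟩ := hbij.2 g
  exact ⟨characterOfFR Q hbij.1 p hg, rfl⟩

lemma contractLeft_algHom_mul (η : A →ₐ[k] k) (x y : A ⊗[k] A) :
    contractLeft η.toLinearMap (x * y) =
      contractLeft η.toLinearMap x * contractLeft η.toLinearMap y := by
  induction x with
  | zero => simp
  | add x x' hx hx' => simp [hx, hx', add_mul]
  | tmul a b =>
    induction y with
    | zero => simp
    | add y y' hy hy' => simp only [map_add, mul_add, hy, hy']
    | tmul c d => simp [smul_smul, mul_comm]

lemma IsGrouplike.map_ne_zero {g : A} (hg : IsGrouplike k A g) (η : A →ₐ[k] k) : η g ≠ 0 := by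
  have h := HopfAlgebra.mul_antipode_rTensor_comul_apply (R := k) g
  rw [hg.1, hg.2] at h
  simp only [LinearMap.rTensor_tmul, LinearMap.mul'_apply, map_one] at h
  exact right_ne_zero_of_mul_eq_one (by rw [← map_mul, h, map_one])

lemma IsGrouplike.commute_fR (Q : QuasiTriangular k A) {g : A} (hg : IsGrouplike k A g)
    (η : A →ₐ[k] k) : g * fR k Q η.toLinearMap = fR k Q η.toLinearMap * g := by
  have h := congrArg (contractLeft η.toLinearMap) (Q.intertwine g)
  rw [hg.2, contractLeft_algHom_mul, contractLeft_algHom_mul, ← fR_apply] at h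
  simp only [TensorProduct.comm_tmul, contractLeft_tmul, AlgHom.toLinearMap_apply,
    smul_mul_assoc, mul_smul_comm] at h
  exact smul_right_injective A (hg.map_ne_zero η) h

/-- The bijection between grouplike elements and characters inverse to `f_R`. -/
def grouplikeEquivCharacter [FiniteDimensional k A] (Q : QuasiTriangular k A)
    (hbij : Function.Bijective (fR k Q)) :
    {g : A // IsGrouplike k A g} ≃ (A →ₐ[k] k) :=
  (Equiv.ofBijective (fun η : A →ₐ[k] k => ⟨fR k Q η.toLinearMap, isGrouplike_fR Q η⟩)
    ⟨fun _ _ h => AlgHom.toLinearMap_injective (hbij.1 (congrArg Subtype.val h)),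
      fun g => (exists_character_fR_eq hbij g.2).imp fun _ h => Subtype.ext h⟩).symm

lemma fR_grouplikeEquivCharacter [FiniteDimensional k A] (Q : QuasiTriangular k A)
    (hbij : Function.Bijective (fR k Q)) (g : {g : A // IsGrouplike k A g}) :
    fR k Q (grouplikeEquivCharacter Q hbij g).toLinearMap = g :=
  congrArg Subtype.val ((grouplikeEquivCharacter Q hbij).symm_apply_apply g)

end Contraction

section Anticoalgebra

variable {k} {M N : Type*} [AddCommGroup M] [Module k M] [AddCommGroup N] [Module k N]
  {d : M →ₗ[k] M ⊗[k] M} {d' : N →ₗ[k] N ⊗[k] N}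

lemma IsSubcoalgebraOf.map_anti {φ : M →ₗ[k] N}
    (hφ : ∀ m, d' (φ m) = TensorProduct.map φ φ (TensorProduct.comm k M M (d m)))
    {C : Submodule k M} (hC : IsSubcoalgebraOf k d C) : IsSubcoalgebraOf k d' (C.map φ) := by
  rintro _ ⟨x, hx, rfl⟩
  obtain ⟨z, hz⟩ := hC x hx
  refine ⟨TensorProduct.map (φ.submoduleMap C) (φ.submoduleMap C)
    (TensorProduct.comm k C C z), ?_⟩
  rw [hφ, ← hz, ← TensorProduct.map_comm, TensorProduct.map_map, TensorProduct.map_map]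
  rfl

lemma IsSimpleSubcoalgebraOf.map_anti (φ : M ≃ₗ[k] N)
    (hφ : ∀ m, d' (φ m) =
      TensorProduct.map φ.toLinearMap φ.toLinearMap (TensorProduct.comm k M M (d m)))
    {C : Submodule k M} (hC : IsSimpleSubcoalgebraOf k d C) :
    IsSimpleSubcoalgebraOf k d' (C.map φ.toLinearMap) := by
  have hsymm (n : N) : d (φ.symm n) = TensorProduct.map φ.symm.toLinearMap φ.symm.toLinearMap
      (TensorProduct.comm k N N (d' n)) := by
    obtain ⟨m, rfl⟩ := φ.surjective n
    rw [hφ, ← TensorProduct.map_comm, TensorProduct.map_map]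
    simp
  refine ⟨fun h => hC.1 ((Submodule.map_eq_bot_iff (e := φ)).1 h), hC.2.1.map_anti hφ,
    fun D hD hle => ?_⟩
  have hmap : (D.map φ.symm.toLinearMap).map φ.toLinearMap = D := by
    rw [← Submodule.map_comp]
    simp
  have hDC : D.map φ.symm.toLinearMap ≤ C := by
    rintro _ ⟨y, hy, rfl⟩
    obtain ⟨x, hx, rfl⟩ := hle hy
    simpa using hx
  rcases hC.2.2 _ (hD.map_anti hsymm) hDC with h | h
  · left
    rw [← hmap, h, Submodule.map_bot]
  · right
    rw [← hmap, h]

lemma IsPointedOf.of_anti (φ : M ≃ₗ[k] N)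
    (hφ : ∀ m, d' (φ m) =
      TensorProduct.map φ.toLinearMap φ.toLinearMap (TensorProduct.comm k M M (d m)))
    (h : IsPointedOf k d') : IsPointedOf k d := fun C hC => by
  rw [← h _ (hC.map_anti φ hφ)]
  exact (LinearEquiv.finrank_map_eq φ C).symm

end Anticoalgebra

/-- Let `(A,R)` be a minimal triangular Hopf algebra over a field `k` of
characteristic `0`. Then the map `f_R : A^{*cop} → A`, `p ↦ (p ⊗ I)(R)`, is an isomorphism
of Hopf algebras; consequently `G(A) ≅ G(A*)` (the grouplikes of `A` are in multiplicative
bijection with the grouplikes of `A*`, i.e. the characters of `A`), the group `G(A)` is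
abelian, and if `A` is pointed then `A*` is pointed as well. -/
theorem fR_isomorphism_of_minimal_triangular
    (k : Type u) [Field k] [CharZero k]
    (A : Type v) [Ring A] [HopfAlgebra k A] [FiniteDimensional k A]
    (Q : QuasiTriangular k A) (htri : Q.IsTriangular) (hmin : Q.IsMinimal) :
    IsHopfIsoFromDualCop k A (fR k Q) ∧
    (∀ g h : A, IsGrouplike k A g → IsGrouplike k A h → g * h = h * g) ∧
    (∃ e : {g : A // IsGrouplike k A g} ≃ (A →ₐ[k] k),
      ∀ (g h : A) (hg : IsGrouplike k A g) (hh : IsGrouplike k A h)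
        (hgh : IsGrouplike k A (g * h)),
        (e ⟨g * h, hgh⟩).toLinearMap =
          LinearMap.mul' k k ∘ₗ
            TensorProduct.map (e ⟨g, hg⟩).toLinearMap (e ⟨h, hh⟩).toLinearMap ∘ₗ
              Coalgebra.comul (R := k)) ∧
    (IsPointed k A → IsPointedOf k (dualComul k A)) := by
  have hbij := fR_bijective htri hmin
  refine ⟨⟨hbij, fR_conv Q, fR_counit Q, comul_fR Q, counit_fR Q⟩, fun g h hg hh => ?_,
    ⟨grouplikeEquivCharacter Q hbij, fun g h hg hh hgh => ?_⟩,
    IsPointedOf.of_anti (LinearEquiv.ofBijective (fR k Q) hbij) (comul_fR Q)⟩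
  · obtain ⟨η, rfl⟩ := exists_character_fR_eq hbij hh
    exact hg.commute_fR Q η
  · apply hbij.1
    refine (fR_grouplikeEquivCharacter Q hbij _).trans (Eq.trans ?_ (fR_conv Q _ _).symm)
    rw [fR_grouplikeEquivCharacter, fR_grouplikeEquivCharacter]

end Paper
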